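/- Let D ⊂ ℂⁿ be a bounded taut domain with the property that for any two points z₁, z₂ ∈ D there exist a holomorphic map φ : Δ → D with z₁, z₂ ∈ φ(Δ) and a holomorphic map ψ : D → Δ such that ψ(φ(ζ)) = ζ for all ζ ∈ Δ. Then ω_ι^D = ω_K^D, i.e. the injective Kobayashi metric of D coincides with the Kobayashi metric of D at every point and in every direction. -/

import Mathlib

open Metric

/-- A holomorphic map from the unit disk `Δ` into a subset `D ⊂ ℂⁿ`. -/
def IsHolDiskTo {n : ℕ} (D : Set (Fin n → ℂ)) (f : ℂ → Fin n → ℂ) : Prop :=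
  DifferentiableOn ℂ f (ball 0 1) ∧ Set.MapsTo f (ball 0 1) D

/-- A domain `D ⊂ ℂⁿ` is taut if every sequence of holomorphic maps `Δ → D` has a subsequence
which either converges locally uniformly on `Δ` to a holomorphic map `Δ → D`, or is compactly
divergent. -/
def IsTaut {n : ℕ} (D : Set (Fin n → ℂ)) : Prop :=
  ∀ f : ℕ → ℂ → Fin n → ℂ, (∀ j, IsHolDiskTo D (f j)) →
    ∃ φ : ℕ → ℕ, StrictMono φ ∧
      ((∃ g : ℂ → Fin n → ℂ, IsHolDiskTo D g ∧
          TendstoLocallyUniformlyOn (fun j => f (φ j)) g Filter.atTop (ball 0 1)) ∨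
        (∀ K : Set ℂ, K ⊆ ball 0 1 → IsCompact K →
          ∀ C : Set (Fin n → ℂ), C ⊆ D → IsCompact C →
            ∃ N : ℕ, ∀ j ≥ N, ∀ z ∈ K, f (φ j) z ∉ C))

/-- The (infinitesimal) Kobayashi metric of `D ⊂ ℂⁿ` at `x` in direction `v`:
`inf {1/λ : λ > 0, ∃ holomorphic f : Δ → D, f(0) = x, f'(0) = λv}`. -/
noncomputable def kobD {n : ℕ} (D : Set (Fin n → ℂ)) (x v : Fin n → ℂ) : ℝ :=
  sInf {c : ℝ | ∃ (f : ℂ → Fin n → ℂ) (lam : ℝ), 0 < lam ∧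
    IsHolDiskTo D f ∧ f 0 = x ∧ deriv f 0 = lam • v ∧ c = 1 / lam}

/-- The injective (infinitesimal) Kobayashi metric of `D ⊂ ℂⁿ`: the same infimum restricted
to injective holomorphic disks. -/
noncomputable def kobInjD {n : ℕ} (D : Set (Fin n → ℂ)) (x v : Fin n → ℂ) : ℝ :=
  sInf {c : ℝ | ∃ (f : ℂ → Fin n → ℂ) (lam : ℝ), 0 < lam ∧
    IsHolDiskTo D f ∧ Set.InjOn f (ball 0 1) ∧ f 0 = x ∧ deriv f 0 = lam • v ∧ c = 1 / lam}

open Filter Topology ComplexConjugate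

lemma norm_sub_lt_norm_one_sub_conj_mul {a w : ℂ} (ha : ‖a‖ < 1) (hw : ‖w‖ < 1) :
    ‖w - a‖ < ‖1 - conj a * w‖ := by
  have ha' : a.re * a.re + a.im * a.im < 1 := by
    rw [← Complex.normSq_apply, Complex.normSq_eq_norm_sq]
    nlinarith [norm_nonneg a]
  have hw' : w.re * w.re + w.im * w.im < 1 := by
    rw [← Complex.normSq_apply, Complex.normSq_eq_norm_sq]
    nlinarith [norm_nonneg w]
  refine lt_of_pow_lt_pow_left₀ 2 (norm_nonneg _) ?_
  rw [← Complex.normSq_eq_norm_sq, ← Complex.normSq_eq_norm_sq, Complex.normSq_apply,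
    Complex.normSq_apply]
  simp only [Complex.sub_re, Complex.sub_im, Complex.mul_re, Complex.mul_im, Complex.one_re,
    Complex.one_im, Complex.conj_re, Complex.conj_im]
  nlinarith [mul_pos (sub_pos.2 ha') (sub_pos.2 hw')]

/-- The automorphism of the unit disk sending `a` to `0`. -/
noncomputable def diskShift (a w : ℂ) : ℂ := (w - a) / (1 - conj a * w)

lemma one_sub_conj_mul_ne_zero {a w : ℂ} (ha : ‖a‖ < 1) (hw : ‖w‖ < 1) :
    1 - conj a * w ≠ 0 :=
  norm_pos_iff.1 ((norm_nonneg _).trans_lt (norm_sub_lt_norm_one_sub_conj_mul ha hw))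

lemma norm_diskShift_lt_one {a w : ℂ} (ha : ‖a‖ < 1) (hw : ‖w‖ < 1) : ‖diskShift a w‖ < 1 := by
  rw [diskShift, norm_div, div_lt_one (norm_pos_iff.2 (one_sub_conj_mul_ne_zero ha hw))]
  exact norm_sub_lt_norm_one_sub_conj_mul ha hw

lemma diskShift_neg_diskShift {a w : ℂ} (ha : ‖a‖ < 1) (hw : ‖w‖ < 1) :
    diskShift (-a) (diskShift a w) = w := by
  have h₁ := one_sub_conj_mul_ne_zero ha hw
  have h₂ := one_sub_conj_mul_ne_zero (a := -a) (by simpa) (norm_diskShift_lt_one ha hw)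
  rw [diskShift, div_eq_iff h₂, diskShift]
  rw [map_neg, div_eq_mul_inv]
  linear_combination (w - a) * mul_inv_cancel₀ h₁

lemma diskShift_diskShift_neg {a w : ℂ} (ha : ‖a‖ < 1) (hw : ‖w‖ < 1) :
    diskShift a (diskShift (-a) w) = w := by
  simpa using diskShift_neg_diskShift (a := -a) (by simpa) hw

lemma differentiableOn_diskShift {a : ℂ} (ha : ‖a‖ < 1) :
    DifferentiableOn ℂ (diskShift a) (ball 0 1) := by
  unfold diskShift
  refine DifferentiableOn.div (by fun_prop) (by fun_prop) fun w hw => ?_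
  exact one_sub_conj_mul_ne_zero ha (by simpa using hw)

/-- Geodesic disks can be reparametrised to be centred at the first point and to pass through the
second one at a positive real parameter. -/
lemma exists_normalized_geodesic {n : ℕ} {D : Set (Fin n → ℂ)} {x z : Fin n → ℂ} (hxz : x ≠ z)
    {φ : ℂ → Fin n → ℂ} {ψ : (Fin n → ℂ) → ℂ} (hφ : IsHolDiskTo D φ)
    (hx : x ∈ φ '' ball 0 1) (hz : z ∈ φ '' ball 0 1) (hψ : DifferentiableOn ℂ ψ D)
    (hψD : Set.MapsTo ψ D (ball 0 1)) (hψφ : ∀ ζ ∈ ball (0 : ℂ) 1, ψ (φ ζ) = ζ) :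
    ∃ (φ' : ℂ → Fin n → ℂ) (ψ' : (Fin n → ℂ) → ℂ) (t : ℝ), 0 < t ∧ t < 1 ∧ IsHolDiskTo D φ' ∧
      φ' 0 = x ∧ φ' t = z ∧ DifferentiableOn ℂ ψ' D ∧ Set.MapsTo ψ' D (ball 0 1) ∧
      ∀ ζ ∈ ball (0 : ℂ) 1, ψ' (φ' ζ) = ζ := by
  obtain ⟨a, ha, rfl⟩ := hx
  obtain ⟨b, hb, rfl⟩ := hz
  have hab : a ≠ b := fun h => hxz (by rw [h])
  simp only [mem_ball_zero_iff] at ha hb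
  have ha' : ‖-a‖ < 1 := by simpa
  set d := diskShift a b with hd
  have hd0 : d ≠ 0 := div_ne_zero (sub_ne_zero.2 hab.symm) (one_sub_conj_mul_ne_zero ha hb)
  have hd0' : (‖d‖ : ℂ) ≠ 0 := by simpa using hd0
  set c : ℂ := d / ‖d‖ with hc
  have hcn : ‖c‖ = 1 := by simp [hc, hd0]
  have hc0 : c ≠ 0 := by simpa [← norm_pos_iff] using hcn.symm ▸ one_pos
  have hmaps : Set.MapsTo (fun ζ => diskShift (-a) (c * ζ)) (ball 0 1) (ball 0 1) := fun ζ hζ => by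
    simp only [mem_ball_zero_iff] at hζ ⊢
    exact norm_diskShift_lt_one ha' (by simpa [hcn])
  refine ⟨fun ζ => φ (diskShift (-a) (c * ζ)), fun y => c⁻¹ * diskShift a (ψ y), ‖d‖,
    norm_pos_iff.2 hd0, norm_diskShift_lt_one ha hb, ⟨?_, ?_⟩, ?_, ?_, ?_, ?_, ?_⟩
  · refine hφ.1.comp ((differentiableOn_diskShift ha').comp (by fun_prop) fun ζ hζ => ?_) hmaps
    simpa [hcn] using hζ
  · exact hφ.2.comp hmaps
  · simp [diskShift]
  · have : c * ‖d‖ = d := div_mul_cancel₀ _ hd0'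
    simp only [this]
    rw [hd, diskShift_neg_diskShift ha hb]
  · exact ((differentiableOn_diskShift ha).comp hψ hψD).const_mul _
  · intro y hy
    have := hψD hy
    simp only [mem_ball_zero_iff] at this ⊢
    simpa [hcn] using norm_diskShift_lt_one ha this
  · intro ζ hζ
    simp only [hψφ _ (hmaps hζ)]
    rw [diskShift_diskShift_neg ha, inv_mul_cancel_left₀ hc0]
    simpa [hcn] using hζ

/-- Functions from `D` to the unit disk are locally Lipschitz, uniformly in the function. -/
lemma exists_uniform_lipschitz {E : Type*} [NormedAddCommGroup E] [NormedSpace ℂ E] {D : Set E}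
    (hD : IsOpen D) {p : E} (hp : p ∈ D) :
    ∃ r > 0, ∃ L : ℝ, 0 < L ∧ ∀ ψ : E → ℂ, DifferentiableOn ℂ ψ D → Set.MapsTo ψ D (ball 0 1) →
      ∀ y ∈ ball p r, ∀ z ∈ ball p r, ‖ψ y - ψ z‖ ≤ L * ‖y - z‖ := by
  obtain ⟨R, hR, hRD⟩ := Metric.isOpen_iff.1 hD p hp
  refine ⟨R / 3, by positivity, 2 / (2 * R / 3), by positivity, fun ψ hψ hψD y hy z hz => ?_⟩
  have hsub : ball z (2 * R / 3) ⊆ D :=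
    (ball_subset_ball' (by rw [mem_ball] at hz; linarith)).trans hRD
  rw [← dist_eq_norm, ← dist_eq_norm]
  refine Complex.dist_le_div_mul_dist_of_mapsTo_ball (hψ.mono hsub) (fun w hw => ?_) ?_
  · have h₁ := hψD (hsub hw)
    have h₂ := hψD (hsub (mem_ball_self (by positivity : 0 < 2 * R / 3)))
    rw [mem_ball] at h₁ h₂
    rw [mem_closedBall]
    linarith [dist_triangle_right (ψ w) (ψ z) 0]
  · rw [mem_ball] at hy hz ⊢
    linarith [dist_triangle_right y z p]

lemma tendsto_slope_of_tendstoLocallyUniformlyOn {E : Type*} [NormedAddCommGroup E]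
    [NormedSpace ℂ E] {f : ℕ → ℂ → E} {g : ℂ → E} {t : ℕ → ℂ}
    (hf : ∀ k, DifferentiableOn ℂ (f k) (ball 0 1)) (hg : DifferentiableOn ℂ g (ball 0 1))
    (hfg : TendstoLocallyUniformlyOn f g atTop (ball 0 1)) (ht : Tendsto t atTop (𝓝 0))
    (ht0 : ∀ k, t k ≠ 0) :
    Tendsto (fun k => (t k)⁻¹ • (f k (t k) - f k 0)) atTop (𝓝 (deriv g 0)) := by
  have hgd : HasDerivAt g (deriv g 0) 0 :=
    (hg.differentiableAt (ball_mem_nhds 0 one_pos)).hasDerivAt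
  have h₁ : Tendsto (fun k => (t k)⁻¹ • (g (t k) - g 0)) atTop (𝓝 (deriv g 0)) := by
    have := hgd.tendsto_slope_zero.comp
      (tendsto_nhdsWithin_iff.2 ⟨ht, Eventually.of_forall ht0⟩)
    simpa [Function.comp_def] using this
  have hu : TendstoUniformlyOn f g atTop (closedBall 0 (1 / 2)) :=
    (tendstoLocallyUniformlyOn_iff_forall_isCompact isOpen_ball).1 hfg _
      (closedBall_subset_ball (by norm_num)) (isCompact_closedBall _ _)
  have h₂ : Tendsto (fun k => (t k)⁻¹ • (f k (t k) - f k 0) - (t k)⁻¹ • (g (t k) - g 0))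
      atTop (𝓝 0) := by
    rw [Metric.tendsto_nhds]
    intro ε hε
    filter_upwards [Metric.tendstoUniformlyOn_iff.1 hu (ε / 8) (by positivity),
      ht.eventually (ball_mem_nhds (0 : ℂ) (by norm_num : (0 : ℝ) < 1 / 2))] with k hk htk
    have hsub : ball (0 : ℂ) (1 / 2) ⊆ ball 0 1 := ball_subset_ball (by norm_num)
    have hS := Complex.dist_le_div_mul_dist_of_mapsTo_ball (f := fun ζ => f k ζ - g ζ)
      (R₂ := ε / 4) (((hf k).sub hg).mono hsub) (fun ζ hζ => ?_) htk
    · rw [dist_zero_right, ← smul_sub, norm_smul, norm_inv]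
      have hpos : 0 < ‖t k‖ := norm_pos_iff.2 (ht0 k)
      rw [inv_mul_lt_iff₀ hpos]
      rw [dist_eq_norm, dist_zero_right] at hS
      calc _ = ‖f k (t k) - g (t k) - (f k 0 - g 0)‖ := by congr 1; abel
        _ ≤ _ := hS
        _ < ‖t k‖ * ε := by nlinarith
    · have a₁ := hk ζ (ball_subset_closedBall hζ)
      have a₂ := hk 0 (mem_closedBall_self (by norm_num))
      rw [dist_eq_norm, norm_sub_rev] at a₁ a₂
      rw [mem_closedBall, dist_eq_norm]
      linarith [norm_sub_le (f k ζ - g ζ) (f k 0 - g 0)]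
  simpa using h₂.add h₁

/-- The left inverses of a locally uniformly convergent sequence of geodesic disks force the limit
to be injective. -/
lemma injOn_of_tendstoLocallyUniformlyOn {n : ℕ} {D : Set (Fin n → ℂ)} (hD : IsOpen D)
    {f : ℕ → ℂ → Fin n → ℂ} {ψ : ℕ → (Fin n → ℂ) → ℂ} {g : ℂ → Fin n → ℂ}
    (hψ : ∀ k, DifferentiableOn ℂ (ψ k) D) (hψD : ∀ k, Set.MapsTo (ψ k) D (ball 0 1))
    (hψf : ∀ k, ∀ ζ ∈ ball (0 : ℂ) 1, ψ k (f k ζ) = ζ) (hg : Set.MapsTo g (ball 0 1) D)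
    (hfg : TendstoLocallyUniformlyOn f g atTop (ball 0 1)) : Set.InjOn g (ball 0 1) := by
  intro a ha b hb hab
  obtain ⟨r, hr, L, hL, hLip⟩ := exists_uniform_lipschitz hD (hg ha)
  have ta : Tendsto (fun k => f k a) atTop (𝓝 (g a)) := hfg.tendsto_at ha
  have tb : Tendsto (fun k => f k b) atTop (𝓝 (g a)) := hab ▸ hfg.tendsto_at hb
  have hlim : Tendsto (fun k => L * ‖f k a - f k b‖) atTop (𝓝 0) := by
    simpa using (ta.sub tb).norm.const_mul L
  have hle : ‖a - b‖ ≤ 0 := by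
    refine ge_of_tendsto hlim ?_
    filter_upwards [ta.eventually (ball_mem_nhds _ hr), tb.eventually (ball_mem_nhds _ hr)]
      with k hka hkb
    simpa [hψf k a ha, hψf k b hb] using hLip (ψ k) (hψ k) (hψD k) _ hka _ hkb
  exact sub_eq_zero.1 (norm_le_zero_iff.1 hle)

/-- In every nonzero direction there is an injective disk which is extremal for the Kobayashi
metric. -/
lemma exists_injOn_extremal_disk {n : ℕ} {D : Set (Fin n → ℂ)} (hD : IsOpen D) (hDtaut : IsTaut D)
    (hgeo : ∀ z₁ ∈ D, ∀ z₂ ∈ D, ∃ (φ : ℂ → Fin n → ℂ) (ψ : (Fin n → ℂ) → ℂ),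
      IsHolDiskTo D φ ∧ z₁ ∈ φ '' ball 0 1 ∧ z₂ ∈ φ '' ball 0 1 ∧
      DifferentiableOn ℂ ψ D ∧ Set.MapsTo ψ D (ball 0 1) ∧
      ∀ ζ ∈ ball (0 : ℂ) 1, ψ (φ ζ) = ζ)
    {x v : Fin n → ℂ} (hx : x ∈ D) (hv : v ≠ 0) :
    ∃ (g : ℂ → Fin n → ℂ) (μ : ℝ), IsHolDiskTo D g ∧ Set.InjOn g (ball 0 1) ∧ g 0 = x ∧
      deriv g 0 = μ • v ∧ ∀ (f : ℂ → Fin n → ℂ) (lam : ℝ), 0 < lam → IsHolDiskTo D f → f 0 = x →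
        deriv f 0 = lam • v → lam ≤ μ := by
  have hv' : 0 < ‖v‖ := norm_pos_iff.2 hv
  obtain ⟨ε₀, hε₀pos, hε₀D, hε₀⟩ : ∃ ε : ℕ → ℝ, (∀ j, 0 < ε j) ∧ (∀ j, x + ε j • v ∈ D) ∧
      Tendsto ε atTop (𝓝 0) := by
    have hlim : Tendsto (fun e : ℝ => x + e • v) (𝓝 0) (𝓝 x) := by
      have : Continuous (fun e : ℝ => x + e • v) := by fun_prop
      simpa using this.tendsto 0
    obtain ⟨δ, hδ, hδD⟩ := Metric.eventually_nhds_iff.1 (hlim.eventually (hD.mem_nhds hx))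
    refine ⟨fun j => δ / (j + 2), fun j => by positivity, fun j => hδD ?_, ?_⟩
    · rw [Real.dist_eq, sub_zero, abs_of_pos (by positivity)]
      exact div_lt_self hδ (by linarith [j.cast_nonneg (α := ℝ)])
    · exact tendsto_const_nhds.div_atTop
        (tendsto_atTop_add_const_right _ _ tendsto_natCast_atTop_atTop)
  have hne : ∀ j, x ≠ x + ε₀ j • v := fun j h =>
    smul_ne_zero (hε₀pos j).ne' hv (left_eq_add.1 h)
  have hnorm : ∀ j, ∃ (φ : ℂ → Fin n → ℂ) (ψ : (Fin n → ℂ) → ℂ) (t : ℝ), 0 < t ∧ t < 1 ∧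
      IsHolDiskTo D φ ∧ φ 0 = x ∧ φ t = x + ε₀ j • v ∧ DifferentiableOn ℂ ψ D ∧
      Set.MapsTo ψ D (ball 0 1) ∧ ∀ ζ ∈ ball (0 : ℂ) 1, ψ (φ ζ) = ζ := fun j => by
    obtain ⟨φ, ψ, h₁, h₂, h₃, h₄, h₅, h₆⟩ := hgeo x hx _ (hε₀D j)
    exact exists_normalized_geodesic (hne j) h₁ h₂ h₃ h₄ h₅ h₆
  choose φ ψ₀ t₀ ht₀pos ht₀lt hφ hφ0 hφt hψ₀ hψ₀D hψ₀φ using hnorm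
  obtain ⟨σ, hσ, ⟨g, hg, hconv⟩ | hdiv⟩ := hDtaut φ hφ
  swap
  · obtain ⟨N, hN⟩ := hdiv {0} (by simp) isCompact_singleton {x} (by simpa) isCompact_singleton
    exact absurd (hφ0 (σ N)) (hN N le_rfl 0 rfl)
  obtain ⟨f, hf⟩ : ∃ f, f = fun k => φ (σ k) := ⟨_, rfl⟩
  obtain ⟨ψ, hψe⟩ : ∃ ψ, ψ = fun k => ψ₀ (σ k) := ⟨_, rfl⟩
  obtain ⟨t, hte⟩ : ∃ t, t = fun k => t₀ (σ k) := ⟨_, rfl⟩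
  obtain ⟨ε, hεe⟩ : ∃ ε, ε = fun k => ε₀ (σ k) := ⟨_, rfl⟩
  have hεpos : ∀ k, 0 < ε k := fun k => by simpa [hεe] using hε₀pos (σ k)
  have hε : Tendsto ε atTop (𝓝 0) := hεe ▸ hε₀.comp hσ.tendsto_atTop
  have htpos : ∀ k, 0 < t k := fun k => by simpa [hte] using ht₀pos (σ k)
  have htlt : ∀ k, t k < 1 := fun k => by simpa [hte] using ht₀lt (σ k)
  have hfD : ∀ k, IsHolDiskTo D (f k) := fun k => by simpa [hf] using hφ (σ k)
  have hf0 : ∀ k, f k 0 = x := fun k => by simpa [hf] using hφ0 (σ k)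
  have hft : ∀ k, f k (t k) = x + ε k • v := fun k => by simpa only [hf, hte, hεe] using hφt (σ k)
  have hψ : ∀ k, DifferentiableOn ℂ (ψ k) D := fun k => by simpa [hψe] using hψ₀ (σ k)
  have hψD : ∀ k, Set.MapsTo (ψ k) D (ball 0 1) := fun k => by simpa [hψe] using hψ₀D (σ k)
  have hψf : ∀ k, ∀ ζ ∈ ball (0 : ℂ) 1, ψ k (f k ζ) = ζ := fun k => by
    simpa only [hψe, hf] using hψ₀φ (σ k)
  replace hconv : TendstoLocallyUniformlyOn f g atTop (ball 0 1) := hf ▸ hconv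
  clear hψ₀φ hψ₀D hψ₀ hφt hφ0 hφ ht₀lt ht₀pos hne hε₀ hε₀D hε₀pos
  have h0 : (0 : ℂ) ∈ ball (0 : ℂ) 1 := mem_ball_self one_pos
  have hψx : ∀ k, ψ k x = 0 := fun k => by rw [← hf0 k, hψf k 0 h0]
  have hψt : ∀ k, ψ k (x + ε k • v) = t k := fun k => by
    rw [← hft k, hψf k]
    simpa [abs_of_pos (htpos k)] using htlt k
  have hg0 : g 0 = x :=
    tendsto_nhds_unique (hconv.tendsto_at h0) (by simp [hf0])
  obtain ⟨r, hr, L, hL, hLip⟩ := exists_uniform_lipschitz hD hx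
  have hzlim : Tendsto (fun k => x + ε k • v) atTop (𝓝 x) := by
    simpa using (hε.smul_const v).const_add x
  have ht : Tendsto t atTop (𝓝 0) := by
    have hlim : Tendsto (fun k => L * ‖ε k • v‖) atTop (𝓝 0) := by
      simpa using (hε.smul_const v).norm.const_mul L
    refine squeeze_zero' (Eventually.of_forall fun k => (htpos k).le) ?_ hlim
    filter_upwards [hzlim.eventually (ball_mem_nhds _ hr)] with k hk
    simpa [hψx, hψt, abs_of_pos (htpos k)] using
      hLip (ψ k) (hψ k) (hψD k) _ hk x (mem_ball_self hr)
  have hslope : Tendsto (fun k => (ε k / t k) • v) atTop (𝓝 (deriv g 0)) := by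
    have htc : Tendsto (fun k => (t k : ℂ)) atTop (𝓝 0) := by
      simpa [Function.comp_def] using (Complex.continuous_ofReal.tendsto 0).comp ht
    have := tendsto_slope_of_tendstoLocallyUniformlyOn (fun k => (hfD k).1) hg.1 hconv htc
      (fun k => by exact_mod_cast (htpos k).ne')
    refine this.congr fun k => ?_
    rw [hft, hf0, add_sub_cancel_left, ← Complex.ofReal_inv, Complex.coe_smul, smul_smul,
      div_eq_inv_mul]
  have hq : Tendsto (fun k => ε k / t k) atTop (𝓝 (‖deriv g 0‖ / ‖v‖)) := by
    refine (hslope.norm.div_const ‖v‖).congr fun k => ?_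
    rw [norm_smul, Real.norm_of_nonneg (div_pos (hεpos k) (htpos k)).le,
      mul_div_cancel_right₀ _ hv'.ne']
  refine ⟨g, ‖deriv g 0‖ / ‖v‖, hg, injOn_of_tendstoLocallyUniformlyOn hD hψ hψD hψf hg.2 hconv,
    hg0, tendsto_nhds_unique hslope (hq.smul_const v), fun h lam hlam hh hh0 hh' => ?_⟩
  have hs : Tendsto (fun k => ((ε k / lam : ℝ) : ℂ)) atTop (𝓝 0) := by
    have h₁ : Tendsto (fun k => ε k / lam) atTop (𝓝 0) := by simpa using hε.div_const lam
    simpa only [Function.comp_def, Complex.ofReal_zero] using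
      (Complex.continuous_ofReal.tendsto 0).comp h₁
  have hhd : HasDerivAt h (lam • v) 0 :=
    hh' ▸ (hh.1.differentiableAt (ball_mem_nhds 0 one_pos)).hasDerivAt
  have hhlim : Tendsto (fun k => h ((ε k / lam : ℝ) : ℂ)) atTop (𝓝 x) :=
    hh0 ▸ hhd.continuousAt.tendsto.comp hs
  have herr : Tendsto (fun k => ‖(ε k)⁻¹ • (h ((ε k / lam : ℝ) : ℂ) - x) - v‖) atTop (𝓝 0) := by
    have h₁ := hhd.tendsto_slope_zero.comp (tendsto_nhdsWithin_iff.2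
      ⟨hs, Eventually.of_forall fun k => by
        simpa using ⟨(hεpos k).ne', hlam.ne'⟩⟩)
    have h₂ := ((h₁.const_smul lam⁻¹).sub_const v).norm
    rw [smul_smul, inv_mul_cancel₀ hlam.ne', one_smul, sub_self, norm_zero] at h₂
    refine h₂.congr fun k => ?_
    simp only [Function.comp_apply, zero_add, hh0]
    rw [← Complex.ofReal_inv, Complex.coe_smul, smul_smul, inv_div, ← mul_div_assoc,
      inv_mul_cancel₀ hlam.ne', one_div]
  have hkey : ∀ᶠ k in atTop,
      1 ≤ ε k / t k * (1 / lam + L * ‖(ε k)⁻¹ • (h ((ε k / lam : ℝ) : ℂ) - x) - v‖) := by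
    filter_upwards [hzlim.eventually (ball_mem_nhds _ hr), hhlim.eventually (ball_mem_nhds _ hr),
      hs.eventually (ball_mem_nhds _ one_pos)] with k hk₁ hk₂ hk₃
    have hS : ‖ψ k (h ((ε k / lam : ℝ) : ℂ))‖ ≤ ε k / lam := by
      have := Complex.norm_le_norm_of_mapsTo_ball (f := fun ζ => ψ k (h ζ)) (R := 1)
        ((hψ k).comp hh.1 hh.2) (((hψD k).comp hh.2).mono_right ball_subset_closedBall)
        (by simp only [hh0, hψx]) (mem_ball_zero_iff.1 hk₃)
      rwa [Complex.norm_real, Real.norm_of_nonneg (div_pos (hεpos k) hlam).le] at this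
    have hl := hLip (ψ k) (hψ k) (hψD k) _ hk₂ _ hk₁
    have hn : ‖(t k : ℂ)‖ = t k := by simp [abs_of_pos (htpos k)]
    have htr := norm_sub_norm_le (t k : ℂ) (ψ k (h ((ε k / lam : ℝ) : ℂ)))
    rw [norm_sub_rev, hn] at htr
    rw [hψt] at hl
    have he : ‖h ((ε k / lam : ℝ) : ℂ) - (x + ε k • v)‖
        = ε k * ‖(ε k)⁻¹ • (h ((ε k / lam : ℝ) : ℂ) - x) - v‖ := by
      rw [← Real.norm_of_nonneg (hεpos k).le, ← norm_smul, Real.norm_of_nonneg (hεpos k).le,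
        smul_sub, smul_smul, mul_inv_cancel₀ (hεpos k).ne', one_smul, sub_sub]
    rw [he] at hl
    rw [div_mul_eq_mul_div, le_div_iff₀ (htpos k), one_mul]
    calc t k ≤ ε k / lam + L * (ε k * ‖(ε k)⁻¹ • (h ((ε k / lam : ℝ) : ℂ) - x) - v‖) := by
          linarith
      _ = _ := by ring
  have hfin := ge_of_tendsto (hq.mul ((herr.const_mul L).const_add (1 / lam))) hkey
  rwa [mul_zero, add_zero, mul_one_div, le_div_iff₀ hlam, one_mul] at hfin

lemma sInf_eq_zero_of_forall_pos_mem {S : Set ℝ} (hS : ∀ c ∈ S, 0 < c)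
    (h : S.Nonempty → ∀ c, 0 < c → c ∈ S) : sInf S = 0 := by
  rcases S.eq_empty_or_nonempty with rfl | hne
  · exact Real.sInf_empty
  · rw [show S = Set.Ioi 0 from Set.Subset.antisymm hS fun c hc => h hne c hc, csInf_Ioi]

lemma kobD_zero {n : ℕ} (D : Set (Fin n → ℂ)) (x : Fin n → ℂ) : kobD D x 0 = 0 := by
  refine sInf_eq_zero_of_forall_pos_mem ?_ ?_
  · rintro c ⟨f, lam, hlam, -, -, -, rfl⟩
    positivity
  · rintro ⟨_, f, lam, -, hf, hf0, hf', -⟩ c hc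
    exact ⟨f, 1 / c, by positivity, hf, hf0, by simpa using hf', by simp⟩

lemma kobInjD_zero {n : ℕ} (D : Set (Fin n → ℂ)) (x : Fin n → ℂ) : kobInjD D x 0 = 0 := by
  refine sInf_eq_zero_of_forall_pos_mem ?_ ?_
  · rintro c ⟨f, lam, hlam, -, -, -, -, rfl⟩
    positivity
  · rintro ⟨_, f, lam, -, hf, hinj, hf0, hf', -⟩ c hc
    exact ⟨f, 1 / c, by positivity, hf, hinj, hf0, by simpa using hf', by simp⟩

/-- If `D ⊂ ℂⁿ` is a bounded taut domain such that any two points of `D` lie on a holomorphic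
disk `φ : Δ → D` admitting a holomorphic left inverse `ψ : D → Δ`, then the injective
Kobayashi metric of `D` coincides with its Kobayashi metric. -/
theorem stmt16 (n : ℕ) (D : Set (Fin n → ℂ)) (hDopen : IsOpen D) (hDconn : IsConnected D)
    (hDbdd : Bornology.IsBounded D) (hDtaut : IsTaut D)
    (hgeo : ∀ z₁ ∈ D, ∀ z₂ ∈ D, ∃ (φ : ℂ → Fin n → ℂ) (ψ : (Fin n → ℂ) → ℂ),
      IsHolDiskTo D φ ∧ z₁ ∈ φ '' ball 0 1 ∧ z₂ ∈ φ '' ball 0 1 ∧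
      DifferentiableOn ℂ ψ D ∧ Set.MapsTo ψ D (ball 0 1) ∧
      ∀ ζ ∈ ball (0 : ℂ) 1, ψ (φ ζ) = ζ) :
    ∀ x ∈ D, ∀ v : Fin n → ℂ, kobInjD D x v = kobD D x v := by
  intro x hx v
  rcases eq_or_ne v 0 with rfl | hv
  · rw [kobD_zero, kobInjD_zero]
  obtain ⟨g, μ, hg, hinj, hg0, hg', hext⟩ := exists_injOn_extremal_disk hDopen hDtaut hgeo hx hv
  unfold kobInjD kobD
  set S := {c : ℝ | ∃ (f : ℂ → Fin n → ℂ) (lam : ℝ), 0 < lam ∧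
    IsHolDiskTo D f ∧ f 0 = x ∧ deriv f 0 = lam • v ∧ c = 1 / lam}
  set T := {c : ℝ | ∃ (f : ℂ → Fin n → ℂ) (lam : ℝ), 0 < lam ∧ IsHolDiskTo D f ∧
    Set.InjOn f (ball 0 1) ∧ f 0 = x ∧ deriv f 0 = lam • v ∧ c = 1 / lam}
  have hTS : T ⊆ S := fun c ⟨f, lam, hlam, hf, _, h⟩ => ⟨f, lam, hlam, hf, h⟩
  rcases S.eq_empty_or_nonempty with hS0 | ⟨_, f, lam, hlam, hf, hf0, hf', -⟩
  · have hT0 : T = ∅ := Set.subset_empty_iff.1 (hTS.trans hS0.subset)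
    rw [hS0, hT0]
  have hμ : 0 < μ := hlam.trans_le (hext f lam hlam hf hf0 hf')
  have hmem : 1 / μ ∈ T := ⟨g, μ, hμ, hg, hinj, hg0, hg', rfl⟩
  have hle : ∀ c ∈ S, 1 / μ ≤ c := by
    rintro c ⟨f, lam, hlam, hf, hf0, hf', rfl⟩
    exact one_div_le_one_div_of_le hlam (hext f lam hlam hf hf0 hf')
  have hSl : IsLeast S (1 / μ) := ⟨hTS hmem, hle⟩
  have hTl : IsLeast T (1 / μ) := ⟨hmem, fun c hc => hle c (hTS hc)⟩
  rw [hSl.csInf_eq, hTl.csInf_eq]
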